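/- arXiv:2001.07275 — 7 statements merged into one kernel-verified Lean document; each statement's English description precedes it below -/
import Mathlib

section
/- Let G be a finite nilpotent group of order n and let H be a subgroup of G of order m. Then ψ_H(G) ≤ ψ_{H_m}(C_n), where C_n is the cyclic group of order n and H_m is its unique subgroup of order m. -/
/-- The order of `x` relative to the subgroup `H`: the smallest positive
integer `k` such that `x ^ k ∈ H`. -/
noncomputable def relOrder {G : Type*} [Group G] (H : Subgroup G) (x : G) : ℕ :=
  sInf {k : ℕ | 0 < k ∧ x ^ k ∈ H}

/-- `ψ_H(G)`: the sum over all elements of `G` of their orders relative to `H`. -/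
noncomputable def psiRel (G : Type*) [Group G] (H : Subgroup G) : ℕ :=
  ∑ᶠ x : G, relOrder H x

/-- `ψ(G)`: the sum of the orders of the elements of `G`. -/
noncomputable def psiSum (G : Type*) [Group G] : ℕ :=
  ∑ᶠ x : G, orderOf x

theorem relOrder_le {G : Type*} [Group G] {H : Subgroup G} {x : G} {k : ℕ}
    (hk : 0 < k) (hx : x ^ k ∈ H) : relOrder H x ≤ k :=
  Nat.sInf_le ⟨hk, hx⟩

theorem relOrder_eq_orderOf_mk {G : Type*} [Group G] [Finite G] (H : Subgroup G) [H.Normal]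
    (x : G) : relOrder H x = orderOf (x : G ⧸ H) := by
  have key : ∀ k : ℕ, x ^ k ∈ H ↔ (x : G ⧸ H) ^ k = 1 := fun k => by
    rw [← QuotientGroup.mk_pow, QuotientGroup.eq_one_iff]
  have hpos : 0 < orderOf (x : G ⧸ H) := orderOf_pos _
  refine le_antisymm (relOrder_le hpos ((key _).2 (pow_orderOf_eq_one _))) ?_
  have hne : {k : ℕ | 0 < k ∧ x ^ k ∈ H}.Nonempty :=
    ⟨_, hpos, (key _).2 (pow_orderOf_eq_one _)⟩
  obtain ⟨h0, hmem⟩ := Nat.sInf_mem hne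
  exact orderOf_le_of_pow_eq_one h0 ((key _).1 hmem)

/-- `f` assigns to each `x : G` an exponent dividing the index of `H` that moves `x` into `H`, with
as many elements of exponent dividing `d` as in the cyclic group of the same order. -/
structure IsCyclicExponent {G : Type*} [Group G] (H : Subgroup G) (f : G → ℕ) : Prop where
  pow_mem : ∀ x, x ^ f x ∈ H
  dvd_index : ∀ x, f x ∣ H.index
  card_dvd : ∀ d, d ∣ H.index → Nat.card {x // f x ∣ d} = d * Nat.card H

theorem IsCyclicExponent.comap {G G' : Type*} [Group G] [Group G'] (e : G ≃* G')
    {H : Subgroup G} {f : G' → ℕ} (hf : IsCyclicExponent (H.map e.toMonoidHom) f) :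
    IsCyclicExponent H (f ∘ e) := by
  have hindex : (H.map e.toMonoidHom).index = H.index := Subgroup.index_map_equiv H e
  have hcard : Nat.card (H.map e.toMonoidHom) = Nat.card H :=
    Subgroup.card_map_of_injective e.injective
  refine ⟨fun x => ?_, fun x => hindex ▸ hf.dvd_index (e x), fun d hd => ?_⟩
  · have h := hf.pow_mem (e x)
    rw [← map_pow] at h
    obtain ⟨y, hy, hyx⟩ := h
    exact e.injective hyx ▸ hy
  · rw [← hcard, ← hf.card_dvd d (hindex ▸ hd)]
    exact Nat.card_congr (e.toEquiv.subtypeEquiv fun x => Iff.rfl)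

theorem isCyclicExponent_relOrder {C : Type*} [CommGroup C] [IsCyclic C] [Finite C]
    (H : Subgroup C) : IsCyclicExponent H (relOrder H) := by
  have hdvd : ∀ (x : C) (d : ℕ), relOrder H x ∣ d ↔ x ^ d ∈ H := fun x d => by
    rw [relOrder_eq_orderOf_mk, orderOf_dvd_iff_pow_eq_one, ← QuotientGroup.mk_pow,
      QuotientGroup.eq_one_iff]
  have hker : H = (powMonoidHom (Nat.card H) : C →* C).ker := by
    refine Subgroup.eq_of_le_of_card_ge (fun x hx => ?_) ?_
    · exact congrArg Subtype.val (pow_card_eq_one' (x := (⟨x, hx⟩ : H)))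
    · rw [IsCyclic.card_powMonoidHom_ker, Nat.gcd_eq_right H.card_subgroup_dvd_card]
  refine ⟨fun x => (hdvd x _).1 dvd_rfl, fun x => (hdvd x _).2 (H.pow_index_mem x),
    fun d hd => ?_⟩
  have hmul : d * Nat.card H ∣ Nat.card C := by
    rw [← H.index_mul_card]
    exact mul_dvd_mul_right hd _
  rw [← Nat.gcd_eq_right hmul, ← IsCyclic.card_powMonoidHom_ker]
  refine Nat.card_congr (Equiv.subtypeEquivRight fun x => ?_)
  rw [hdvd, MonoidHom.mem_ker, powMonoidHom_apply, pow_mul]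
  conv_lhs => rw [hker]
  rfl

theorem IsPGroup.exists_exponent {p : ℕ} [hp : Fact p.Prime] {P : Type*} [Group P] [Finite P]
    (hP : IsPGroup p P) (a : ℕ) : ∀ H : Subgroup P, H.index = p ^ a →
      ∃ g : P → ℕ, (∀ x, x ^ p ^ g x ∈ H) ∧ (∀ x, g x ≤ a) ∧ (∀ x, g x = 0 ↔ x ∈ H) ∧
        ∀ i ≤ a, Nat.card {x // g x ≤ i} = p ^ i * Nat.card H := by
  classical
  induction a with
  | zero =>
    intro H hH
    have hH : H = ⊤ := Subgroup.index_eq_one.1 (by simpa using hH)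
    subst hH
    exact ⟨fun _ => 0, by simp, by simp, by simp, by simp⟩
  | succ a ih =>
    intro H hH
    obtain ⟨c, hc⟩ := (hP.to_subgroup H).exists_card_eq
    have hPcard : p ^ c * p ^ (a + 1) = Nat.card P := by rw [← hc, ← hH, H.card_mul_index]
    obtain ⟨K, hK, hHK⟩ := Sylow.exists_subgroup_card_pow_succ (p := p) (n := c)
      (by rw [← hPcard]; exact ⟨p ^ a, by ring⟩) hc
    have hKindex : K.index = p ^ a := by
      have h := K.card_mul_index
      rw [hK, ← hPcard] at h
      exact Nat.eq_of_mul_eq_mul_left (pow_pos hp.out.pos (c + 1)) (by rw [h]; ring)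
    have hrel : (H.subgroupOf K).index = p := by
      have h := H.relIndex_mul_index hHK
      rw [hKindex, hH, pow_succ'] at h
      exact Nat.eq_of_mul_eq_mul_right (pow_pos hp.out.pos a) h
    have hnormal : (H.subgroupOf K).Normal := by
      apply Subgroup.normal_of_index_eq_minFac_card
      rw [hrel, hK, hp.out.pow_minFac (Nat.succ_ne_zero c)]
    obtain ⟨g, hg, hga, hg0, hgc⟩ := ih K hKindex
    refine ⟨fun x => if x ∈ H then 0 else g x + 1, fun x => ?_, fun x => ?_, fun x => ?_, ?_⟩
    · by_cases hx : x ∈ H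
      · simp [hx]
      · have h := (H.subgroupOf K).pow_index_mem ⟨_, hg x⟩
        rw [hrel, Subgroup.mem_subgroupOf] at h
        simpa [hx, pow_succ, pow_mul] using h
    · have := hga x
      dsimp only
      split_ifs <;> omega
    · by_cases hx : x ∈ H <;> simp [hx]
    · rintro (_ | i) hi
      · rw [pow_zero, one_mul]
        refine Nat.card_congr (Equiv.subtypeEquivRight fun x => ?_)
        by_cases hx : x ∈ H <;> simp [hx]
      · rw [hc, ← pow_add, show i + 1 + c = i + (c + 1) by ring, pow_add, ← hK,
          ← hgc i (by omega)]
        refine Nat.card_congr (Equiv.subtypeEquivRight fun x => ?_)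
        by_cases hx : x ∈ H
        · simp [hx, (hg0 x).2 (hHK hx)]
        · simp [hx]

theorem IsPGroup.exists_isCyclicExponent {p : ℕ} [hp : Fact p.Prime] {P : Type*} [Group P]
    [Finite P] (hP : IsPGroup p P) (H : Subgroup P) : ∃ f : P → ℕ, IsCyclicExponent H f := by
  obtain ⟨a, ha⟩ := hP.index H
  obtain ⟨g, hg, hga, -, hgc⟩ := hP.exists_exponent a H ha
  refine ⟨fun x => p ^ g x, hg, fun x => ha ▸ pow_dvd_pow p (hga x), fun d hd => ?_⟩
  obtain ⟨i, hi, rfl⟩ := (Nat.dvd_prime_pow hp.out).1 (ha ▸ hd)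
  rw [← hgc i hi]
  exact Nat.card_congr (Equiv.subtypeEquivRight fun x =>
    Nat.pow_dvd_pow_iff_le_right hp.out.one_lt)

theorem Nat.gcd_prod_of_pairwise_coprime {ι : Type*} (d : ℕ) (N : ι → ℕ)
    (hN : Pairwise fun i j => (N i).Coprime (N j)) (s : Finset ι) :
    Nat.gcd d (∏ i ∈ s, N i) = ∏ i ∈ s, Nat.gcd d (N i) := by
  classical
  induction s using Finset.induction_on with
  | empty => simp
  | insert i s hi ih =>
    rw [Finset.prod_insert hi, Finset.prod_insert hi, ← ih]
    exact Nat.Coprime.gcd_mul d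
      (Nat.Coprime.prod_right fun j hj => hN (ne_of_mem_of_not_mem hj hi).symm)

theorem Nat.prod_dvd_of_pairwise_coprime {ι : Type*} [Fintype ι] {N : ι → ℕ} {d : ℕ}
    (hN : Pairwise fun i j => (N i).Coprime (N j)) (hd : ∀ i, N i ∣ d) : ∏ i, N i ∣ d :=
  Fintype.prod_dvd_of_isRelPrime (fun _ _ hij => Nat.coprime_iff_isRelPrime.1 (hN hij)) hd

theorem Subgroup.card_pi_univ {ι : Type*} [Fintype ι] {Q : ι → Type*} [∀ i, Group (Q i)]
    (H : ∀ i, Subgroup (Q i)) : Nat.card (Subgroup.pi Set.univ H) = ∏ i, Nat.card (H i) := by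
  rw [← Nat.card_pi]
  exact Nat.card_congr (Equiv.Set.univPi fun i => (H i : Set (Q i)))

theorem Subgroup.eq_pi_map_eval_of_coprime {ι : Type*} [Fintype ι] {Q : ι → Type*}
    [∀ i, Group (Q i)] [∀ i, Finite (Q i)]
    (hQ : Pairwise fun i j => (Nat.card (Q i)).Coprime (Nat.card (Q j)))
    (H : Subgroup (∀ i, Q i)) :
    H = Subgroup.pi Set.univ fun i => H.map (Pi.evalMonoidHom Q i) := by
  refine Subgroup.eq_of_le_of_card_ge (fun x hx i _ => ⟨x, hx, rfl⟩) ?_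
  refine Nat.le_of_dvd Nat.card_pos ?_
  rw [Subgroup.card_pi_univ]
  exact Nat.prod_dvd_of_pairwise_coprime
    (fun i j hij => (hQ hij).of_dvd (Subgroup.card_subgroup_dvd_card _)
      (Subgroup.card_subgroup_dvd_card _))
    fun i => H.card_map_dvd _

theorem IsCyclicExponent.pi {ι : Type*} [Fintype ι] {Q : ι → Type*}
    [∀ i, Group (Q i)] [∀ i, Finite (Q i)]
    (hQ : Pairwise fun i j => (Nat.card (Q i)).Coprime (Nat.card (Q j)))
    {H : ∀ i, Subgroup (Q i)} {f : ∀ i, Q i → ℕ} (hf : ∀ i, IsCyclicExponent (H i) (f i)) :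
    IsCyclicExponent (Subgroup.pi Set.univ H) fun x => ∏ i, f i (x i) := by
  have hcard : Nat.card (Subgroup.pi Set.univ H) = ∏ i, Nat.card (H i) :=
    Subgroup.card_pi_univ H
  have hindex : (Subgroup.pi Set.univ H).index = ∏ i, (H i).index := by
    refine Nat.eq_of_mul_eq_mul_left (Nat.card_pos (α := Subgroup.pi Set.univ H)) ?_
    rw [Subgroup.card_mul_index, hcard, ← Finset.prod_mul_distrib, Nat.card_pi]
    exact Finset.prod_congr rfl fun i _ => ((H i).card_mul_index).symm
  have hcop : Pairwise fun i j => ((H i).index).Coprime (H j).index :=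
    fun i j hij => (hQ hij).of_dvd (H i).index_dvd_card (H j).index_dvd_card
  refine ⟨fun x i _ => ?_, fun x => ?_, fun d hd => ?_⟩
  · obtain ⟨k, hk⟩ := Finset.dvd_prod_of_mem (fun i => f i (x i)) (Finset.mem_univ i)
    simp only [hk, Pi.pow_apply, pow_mul]
    exact (H i).pow_mem ((hf i).pow_mem (x i)) k
  · rw [hindex]
    exact Finset.prod_dvd_prod_of_dvd _ _ fun i _ => (hf i).dvd_index (x i)
  · have hprod : d = ∏ i, Nat.gcd d (H i).index := by
      rw [← Nat.gcd_prod_of_pairwise_coprime d _ hcop, ← hindex, Nat.gcd_eq_left hd]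
    have hiff : ∀ x : ∀ i, Q i, ∏ i, f i (x i) ∣ d ↔ ∀ i, f i (x i) ∣ Nat.gcd d (H i).index := by
      refine fun x => ⟨fun h i => Nat.dvd_gcd ?_ ((hf i).dvd_index _), fun h => ?_⟩
      · exact (Finset.dvd_prod_of_mem (fun i => f i (x i)) (Finset.mem_univ i)).trans h
      · exact Nat.prod_dvd_of_pairwise_coprime
          (fun i j hij => (hcop hij).of_dvd ((hf i).dvd_index _) ((hf j).dvd_index _))
          fun i => (h i).trans (Nat.gcd_dvd_left _ _)
    rw [Nat.card_congr ((Equiv.subtypeEquivRight hiff).trans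
        (Equiv.subtypePiEquivPi (p := fun i b => f i b ∣ Nat.gcd d (H i).index))),
      Nat.card_pi, Finset.prod_congr rfl fun i _ => (hf i).card_dvd _ (Nat.gcd_dvd_right _ _),
      Finset.prod_mul_distrib, ← hprod, hcard]

theorem Group.IsNilpotent.exists_isCyclicExponent {G : Type*} [Group G] [Finite G]
    (hG : Group.IsNilpotent G) (H : Subgroup G) : ∃ f : G → ℕ, IsCyclicExponent H f := by
  obtain ⟨e⟩ := ((Group.isNilpotent_of_finite_tfae (G := G)).out 0 4).mp hG
  have hprime : ∀ p : (Nat.card G).primeFactors, Fact (p : ℕ).Prime :=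
    fun p => ⟨Nat.prime_of_mem_primeFactors p.2⟩
  have hP : ∀ p : (Nat.card G).primeFactors, ∃ n, Nat.card (∀ P : Sylow p G, P) = (p : ℕ) ^ n := by
    intro p
    have := Fintype.ofFinite (Sylow p G)
    choose n hn using fun P : Sylow p G => P.isPGroup'.exists_card_eq
    refine ⟨∑ P, n P, ?_⟩
    rw [Nat.card_pi, ← Finset.prod_pow_eq_pow_sum]
    exact Finset.prod_congr rfl fun P _ => hn P
  have hQ : Pairwise fun p q : (Nat.card G).primeFactors =>
      (Nat.card (∀ P : Sylow p G, P)).Coprime (Nat.card (∀ P : Sylow q G, P)) := by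
    intro p q hpq
    obtain ⟨a, ha⟩ := hP p
    obtain ⟨b, hb⟩ := hP q
    rw [ha, hb]
    exact Nat.Coprime.pow _ _ ((Nat.coprime_primes (hprime p).out (hprime q).out).2
      fun h => hpq (Subtype.ext h))
  choose f hf using fun p : (Nat.card G).primeFactors =>
    (IsPGroup.of_card (hP p).choose_spec).exists_isCyclicExponent
      ((H.map e.symm.toMonoidHom).map (Pi.evalMonoidHom _ p))
  have h := IsCyclicExponent.pi hQ hf
  have hpi := Subgroup.eq_pi_map_eval_of_coprime hQ (H.map e.symm.toMonoidHom)
  exact ⟨_, IsCyclicExponent.comap e.symm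
    (hpi.symm.subst (motive := (IsCyclicExponent · _)) h)⟩

theorem card_dvd_eq_sum_divisors {α : Type*} [Fintype α] (f : α → ℕ) {d : ℕ} (hd : d ≠ 0) :
    Nat.card {x // f x ∣ d} = ∑ c ∈ d.divisors, Nat.card {x // f x = c} := by
  classical
  simp only [Nat.card_eq_fintype_card, Fintype.card_subtype]
  rw [Finset.card_eq_sum_card_fiberwise (f := f) (t := d.divisors)
    fun x hx => by simpa [hd] using hx]
  refine Finset.sum_congr rfl fun c hc => congrArg Finset.card ?_
  ext x
  simp only [Finset.mem_filter, Finset.mem_univ, true_and, and_iff_right_iff_imp]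
  rintro rfl
  exact Nat.dvd_of_mem_divisors hc

theorem sum_eq_sum_divisors_mul_card {α : Type*} [Fintype α] {N : ℕ} (hN : N ≠ 0) {f : α → ℕ}
    (hf : ∀ x, f x ∣ N) : ∑ x, f x = ∑ d ∈ N.divisors, d * Nat.card {x // f x = d} := by
  classical
  rw [← Finset.sum_fiberwise_of_maps_to (g := f) (t := N.divisors)
    fun x _ => Nat.mem_divisors.2 ⟨hf x, hN⟩]
  refine Finset.sum_congr rfl fun d _ => ?_
  rw [Finset.sum_congr rfl fun x hx => (Finset.mem_filter.1 hx).2, Finset.sum_const, smul_eq_mul,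
    mul_comm, Nat.card_eq_fintype_card, Fintype.card_subtype]

theorem sum_eq_sum_of_card_dvd_eq {α β : Type*} [Fintype α] [Fintype β] {N : ℕ} (hN : N ≠ 0)
    {f : α → ℕ} {g : β → ℕ} (hf : ∀ x, f x ∣ N) (hg : ∀ y, g y ∣ N)
    (h : ∀ d, d ∣ N → Nat.card {x // f x ∣ d} = Nat.card {y // g y ∣ d}) :
    ∑ x, f x = ∑ y, g y := by
  have key : ∀ d, d ∣ N → Nat.card {x // f x = d} = Nat.card {y // g y = d} := by
    intro d
    induction d using Nat.strong_induction_on with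
    | _ d ih =>
      intro hd
      have hd0 : d ≠ 0 := ne_zero_of_dvd_ne_zero hN hd
      have hcard := h d hd
      rw [card_dvd_eq_sum_divisors f hd0, card_dvd_eq_sum_divisors g hd0,
        ← Nat.insert_self_properDivisors hd0,
        Finset.sum_insert Nat.self_notMem_properDivisors,
        Finset.sum_insert Nat.self_notMem_properDivisors,
        Finset.sum_congr rfl fun c hc => ih c (Nat.mem_properDivisors.1 hc).2
          ((Nat.mem_properDivisors.1 hc).1.trans hd)] at hcard
      exact Nat.add_right_cancel hcard
  rw [sum_eq_sum_divisors_mul_card hN hf, sum_eq_sum_divisors_mul_card hN hg]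
  exact Finset.sum_congr rfl fun d hd => by rw [key d (Nat.dvd_of_mem_divisors hd)]

/-- If `G` is a finite nilpotent group of order `n` and `H ≤ G` has
order `m`, then `ψ_H(G) ≤ ψ_{H_m}(C_n)`, where `H_m` is the (unique) subgroup of
order `m` of the cyclic group `C_n`. -/
theorem psiRel_le_psiRel_cyclic_of_isNilpotent {G : Type*} [Group G] [Finite G]
    (hG : Group.IsNilpotent G) (H : Subgroup G)
    (Hm : Subgroup (Multiplicative (ZMod (Nat.card G))))
    (hm : Nat.card Hm = Nat.card H) :
    psiRel G H ≤ psiRel (Multiplicative (ZMod (Nat.card G))) Hm := by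
  have hindex : Hm.index = H.index := by
    refine Nat.eq_of_mul_eq_mul_left (Nat.card_pos (α := H)) ?_
    rw [H.card_mul_index, ← hm, Hm.card_mul_index]
    exact Nat.card_zmod _
  have : NeZero (Nat.card G) := ⟨Nat.card_pos.ne'⟩
  have : Fintype G := Fintype.ofFinite G
  obtain ⟨f, hf⟩ := hG.exists_isCyclicExponent H
  have hr := isCyclicExponent_relOrder Hm
  have hN : H.index ≠ 0 := Subgroup.index_ne_zero_of_finite
  have hsum : ∑ x, f x = ∑ y, relOrder Hm y :=
    sum_eq_sum_of_card_dvd_eq hN hf.dvd_index (fun y => hindex ▸ hr.dvd_index y) fun d hd => by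
      rw [hf.card_dvd d hd, hr.card_dvd d (hindex ▸ hd), hm]
  rw [psiRel, psiRel, finsum_eq_sum_of_fintype, finsum_eq_sum_of_fintype, ← hsum]
  exact Finset.sum_le_sum fun x _ =>
    relOrder_le (Nat.pos_of_dvd_of_pos (hf.dvd_index x) (Nat.pos_of_ne_zero hN)) (hf.pow_mem x)
end

section
/- Let G be a finite p-group of order p^n and let H be a subgroup of G of order p^m. Then ψ_H(G) ≤ ψ_{H_{p^m}}(C_{p^n}), where C_{p^n} is the cyclic group of order p^n and H_{p^m} is its unique subgroup of order p^m. -/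
section RelativeOrder

variable {G : Type*} [Group G]

lemma relOrder_spec [Finite G] (H : Subgroup G) (x : G) :
    0 < relOrder H x ∧ x ^ relOrder H x ∈ H :=
  Nat.sInf_mem (s := {k : ℕ | 0 < k ∧ x ^ k ∈ H})
    ⟨orderOf x, orderOf_pos x, by simp [pow_orderOf_eq_one]⟩

lemma pow_mem_iff_relOrder_dvd [Finite G] (H : Subgroup G) (x : G) (k : ℕ) :
    x ^ k ∈ H ↔ relOrder H x ∣ k := by
  obtain ⟨hpos, hmem⟩ := relOrder_spec H x
  constructor
  · intro hk
    have hmod : x ^ (k % relOrder H x) ∈ H := by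
      rw [← Nat.mod_add_div k (relOrder H x), pow_add, pow_mul] at hk
      exact (H.mul_mem_cancel_right (H.pow_mem hmem _)).1 hk
    by_contra hdvd
    have hle : relOrder H x ≤ k % relOrder H x :=
      Nat.sInf_le ⟨Nat.pos_of_ne_zero fun h0 => hdvd (Nat.dvd_of_mod_eq_zero h0), hmod⟩
    exact absurd (Nat.mod_lt k hpos) hle.not_gt
  · rintro ⟨c, rfl⟩
    rw [pow_mul]
    exact H.pow_mem hmem c

lemma pow_eq_one_add_sum_ite {p : ℕ} (hp : 0 < p) {j N : ℕ} (hj : j ≤ N) :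
    p ^ j = 1 + ∑ k ∈ Finset.range N, if k < j then p ^ (k + 1) - p ^ k else 0 := by
  induction N, hj using Nat.le_induction with
  | base =>
    rw [Finset.sum_congr rfl fun k hk => if_pos (Finset.mem_range.1 hk),
      Finset.sum_range_tsub (pow_right_mono₀ hp), pow_zero]
    exact (Nat.add_sub_cancel' (Nat.one_le_pow _ _ hp)).symm
  | succ N hN ih => rw [Finset.sum_range_succ, if_neg hN.not_gt, add_zero, ← ih]

open Classical in
lemma relOrder_eq_one_add_sum [Finite G] {p n : ℕ} (hp : p.Prime) (hG : Nat.card G = p ^ n)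
    (H : Subgroup G) (x : G) :
    relOrder H x =
      1 + ∑ k ∈ Finset.range n, if x ^ p ^ k ∉ H then p ^ (k + 1) - p ^ k else 0 := by
  have hdvd : relOrder H x ∣ p ^ n := by
    rw [← pow_mem_iff_relOrder_dvd, ← hG, pow_card_eq_one']
    exact H.one_mem
  obtain ⟨j, hj, hxj⟩ := (Nat.dvd_prime_pow hp).1 hdvd
  simp_rw [pow_mem_iff_relOrder_dvd, hxj, Nat.pow_dvd_pow_iff_le_right hp.one_lt, not_le]
  exact pow_eq_one_add_sum_ite hp.pos hj

open Classical in
lemma psiRel_eq_sum_card [Fintype G] {p n : ℕ} (hp : p.Prime) (hG : Nat.card G = p ^ n)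
    (H : Subgroup G) :
    psiRel G H = p ^ n + ∑ k ∈ Finset.range n,
      (p ^ n - Finset.card {x : G | x ^ p ^ k ∈ H}) * (p ^ (k + 1) - p ^ k) := by
  have hcard (k : ℕ) : Finset.card {x : G | x ^ p ^ k ∉ H} =
      p ^ n - Finset.card {x : G | x ^ p ^ k ∈ H} := by
    rw [← hG, Nat.card_eq_fintype_card, ← Finset.card_compl, Finset.compl_filter]
  rw [psiRel, finsum_eq_sum_of_fintype]
  simp_rw [relOrder_eq_one_add_sum hp hG H]
  rw [Finset.sum_add_distrib, Finset.sum_comm]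
  simp_rw [← Finset.sum_filter, Finset.sum_const, hcard, smul_eq_mul, mul_one]
  rw [Finset.card_univ, ← Nat.card_eq_fintype_card, hG]

lemma exists_subgroup_forall_pow_mem [Finite G] {p n m : ℕ} (hp : p.Prime)
    (hG : Nat.card G = p ^ n) (H : Subgroup G) (hH : Nat.card H = p ^ m) (k : ℕ)
    (hk : m + k ≤ n) :
    ∃ K : Subgroup G, Nat.card K = p ^ (m + k) ∧ ∀ x ∈ K, x ^ p ^ k ∈ H := by
  have : Fact p.Prime := ⟨hp⟩
  induction k with
  | zero => exact ⟨H, hH, by simp⟩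
  | succ k ih =>
    obtain ⟨K, hK, hKH⟩ := ih (by omega)
    obtain ⟨L, hL, hKL⟩ :=
      Sylow.exists_subgroup_card_pow_succ (hG ▸ pow_dvd_pow p hk) hK
    refine ⟨L, hL, fun x hx => ?_⟩
    have hindex : (K.subgroupOf L).index = p := by
      have h := (K.subgroupOf L).card_mul_index
      rw [Nat.card_congr (Subgroup.subgroupOfEquivOfLe hKL).toEquiv, hK, hL, pow_succ] at h
      exact Nat.eq_of_mul_eq_mul_left (pow_pos hp.pos _) h
    have hnormal : (K.subgroupOf L).Normal := by
      apply Subgroup.normal_of_index_eq_minFac_card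
      rw [hindex, hL, hp.pow_minFac (by omega)]
    have hxp : x ^ p ∈ K := by
      simpa [hindex, Subgroup.mem_subgroupOf] using (K.subgroupOf L).pow_index_mem ⟨x, hx⟩
    rw [pow_succ', pow_mul]
    exact hKH _ hxp

open Classical in
lemma card_pow_mem_le_of_isCyclic [Fintype G] [IsCyclic G] {p m : ℕ} (hp : 0 < p)
    (H : Subgroup G) (hH : Nat.card H = p ^ m) (k : ℕ) :
    Finset.card {x : G | x ^ p ^ k ∈ H} ≤ p ^ (m + k) := by
  refine (Finset.card_le_card fun x hx => ?_).trans
    (IsCyclic.card_pow_eq_one_le (α := G) (pow_pos hp (m + k)))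
  simp only [Finset.mem_filter, Finset.mem_univ, true_and] at hx ⊢
  rw [add_comm, pow_add, pow_mul, ← hH]
  exact orderOf_dvd_iff_pow_eq_one.1 (H.orderOf_dvd_natCard hx)

open Classical in
lemma le_card_pow_mem [Fintype G] {p n m : ℕ} (hp : p.Prime) (hG : Nat.card G = p ^ n)
    (H : Subgroup G) (hH : Nat.card H = p ^ m) (k : ℕ) :
    p ^ min (m + k) n ≤ Finset.card {x : G | x ^ p ^ k ∈ H} := by
  have hmn : m ≤ n := by
    rw [← Nat.pow_dvd_pow_iff_le_right hp.one_lt, ← hH, ← hG]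
    exact H.card_subgroup_dvd_card
  obtain ⟨K, hK, hKH⟩ := exists_subgroup_forall_pow_mem hp hG H hH (min k (n - m)) (by omega)
  rw [show min (m + k) n = m + min k (n - m) by omega, ← hK, ← SetLike.coe_sort_coe,
    Nat.card_coe_set_eq, ← Set.ncard_coe_finset]
  refine Set.ncard_le_ncard fun x hx => ?_
  simp only [Finset.coe_filter, Finset.mem_univ, true_and, Set.mem_ofPred_eq]
  rw [pow_mem_iff_relOrder_dvd]
  exact ((pow_mem_iff_relOrder_dvd H x _).1 (hKH x hx)).trans (pow_dvd_pow p (min_le_left _ _))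

end RelativeOrder

/-- If `G` is a finite `p`-group of order `p ^ n` and `H ≤ G` has
order `p ^ m`, then `ψ_H(G) ≤ ψ_{H_{p^m}}(C_{p^n})`. -/
theorem psiRel_le_psiRel_cyclic_of_pGroup {p n m : ℕ} (hp : p.Prime)
    {G : Type*} [Group G] [Finite G] (hG : Nat.card G = p ^ n)
    (H : Subgroup G) (hH : Nat.card H = p ^ m)
    (Hm : Subgroup (Multiplicative (ZMod (p ^ n)))) (hm : Nat.card Hm = p ^ m) :
    psiRel G H ≤ psiRel (Multiplicative (ZMod (p ^ n))) Hm := by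
  classical
  have : NeZero (p ^ n) := ⟨(pow_pos hp.pos n).ne'⟩
  have := Fintype.ofFinite G
  have hC : Nat.card (Multiplicative (ZMod (p ^ n))) = p ^ n := Nat.card_zmod _
  have : Fintype (Multiplicative (ZMod (p ^ n))) := Fintype.ofFinite _
  rw [psiRel_eq_sum_card hp hG, psiRel_eq_sum_card hp hC]
  gcongr with k
  refine le_trans ?_ (le_card_pow_mem hp hG H hH k)
  rcases min_choice (m + k) n with h | h <;> rw [h]
  · exact card_pow_mem_le_of_isCyclic hp.pos Hm hm k
  · exact (Finset.card_le_univ _).trans_eq (by rw [← Nat.card_eq_fintype_card, hC])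
end

section
/- Let G be a finite group of order n and let H be a normal subgroup of G of order m such that the quotient G/H is cyclic. Then ψ_H(G) = ψ_{H_m}(C_n), where C_n is the cyclic group of order n and H_m is its unique subgroup of order m. -/
/-- `ψ_H(G) = |H| ψ(G / H)` for a normal subgroup `H` of a finite group `G`. -/
theorem psiRel_eq_card_mul_psiSum (G : Type*) [Group G] [Finite G] (H : Subgroup G) [H.Normal] :
    psiRel G H = Nat.card H * psiSum (G ⧸ H) := by
  classical
  have := Fintype.ofFinite G
  have := Fintype.ofFinite (G ⧸ H)
  simp only [psiRel, psiSum, finsum_eq_sum_of_fintype, relOrder_eq_orderOf_mk]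
  rw [← Finset.sum_fiberwise' Finset.univ (fun x : G ↦ (x : G ⧸ H)) orderOf, Finset.mul_sum]
  refine Finset.sum_congr rfl fun q _ ↦ ?_
  have hcard := QuotientGroup.card_preimage_mk H {q}
  rw [Nat.card_unique (α := ({q} : Set (G ⧸ H))), mul_one] at hcard
  rw [Finset.sum_const, smul_eq_mul, ← hcard, ← Fintype.card_subtype,
    ← Nat.card_eq_fintype_card]
  rfl

/-- Isomorphic groups have the same sum of element orders. -/
theorem MulEquiv.psiSum_eq {G K : Type*} [Group G] [Group K] (e : G ≃* K) :
    psiSum G = psiSum K :=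
  finsum_eq_of_bijective e e.bijective fun x ↦ (e.orderOf_eq x).symm

/-- If `G` is a finite group of order `n` and `H` is a normal subgroup
of order `m` with `G / H` cyclic, then `ψ_H(G) = ψ_{H_m}(C_n)`, where `H_m` is the
(unique) subgroup of order `m` of the cyclic group `C_n`. -/
theorem psiRel_eq_psiRel_cyclic_of_quotient_cyclic {G : Type*} [Group G] [Finite G]
    (H : Subgroup G) [H.Normal] (hcyc : IsCyclic (G ⧸ H))
    (Hm : Subgroup (Multiplicative (ZMod (Nat.card G))))
    (hm : Nat.card Hm = Nat.card H) :
    psiRel G H = psiRel (Multiplicative (ZMod (Nat.card G))) Hm := by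
  have : NeZero (Nat.card G) := ⟨Nat.card_pos.ne'⟩
  have : Finite (Multiplicative (ZMod (Nat.card G))) :=
    inferInstanceAs (Finite (ZMod (Nat.card G)))
  have hC : Nat.card (Multiplicative (ZMod (Nat.card G))) = Nat.card G := Nat.card_zmod _
  have hquot : Nat.card (G ⧸ H) = Nat.card (Multiplicative (ZMod (Nat.card G)) ⧸ Hm) := by
    refine Nat.eq_of_mul_eq_mul_right (Nat.card_pos (α := H)) ?_
    rw [← Subgroup.card_eq_card_quotient_mul_card_subgroup, ← hm,
      ← Subgroup.card_eq_card_quotient_mul_card_subgroup, hC]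
  have : IsCyclic (Multiplicative (ZMod (Nat.card G)) ⧸ Hm) :=
    isCyclic_of_surjective (QuotientGroup.mk' Hm) (QuotientGroup.mk'_surjective Hm)
  rw [psiRel_eq_card_mul_psiSum, psiRel_eq_card_mul_psiSum, hm,
    (mulEquivOfCyclicCardEq hquot).psiSum_eq]
end

section
/- Let G be a finite group and let K be a normal subgroup of G. Then ψ(G) ≤ |K|² · ψ(G/K) − |K| + 1. -/
theorem orderOf_le_card_mul_orderOf_quotient_mk {G : Type*} [Group G] [Finite G]
    (K : Subgroup G) [K.Normal] (x : G) :
    orderOf x ≤ Nat.card K * orderOf (x : G ⧸ K) := by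
  have hmem : x ^ orderOf (x : G ⧸ K) ∈ K := by
    rw [← QuotientGroup.eq_one_iff, QuotientGroup.mk_pow, pow_orderOf_eq_one]
  refine Nat.le_of_dvd (Nat.mul_pos Nat.card_pos (orderOf_pos _)) (orderOf_dvd_of_pow_eq_one ?_)
  rw [mul_comm, pow_mul]
  exact orderOf_dvd_iff_pow_eq_one.mp (K.orderOf_dvd_natCard hmem)

theorem sum_quotient_mk {G M : Type*} [Group G] [Fintype G] [AddCommMonoid M]
    (K : Subgroup G) [Fintype (G ⧸ K)] (f : G ⧸ K → M) :
    ∑ x : G, f x = Nat.card K • ∑ q : G ⧸ K, f q := by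
  classical
  have hfiber (q : G ⧸ K) : ({x : G | (x : G ⧸ K) = q} : Finset G).card = Nat.card K := by
    simpa using QuotientGroup.card_preimage_mk K {q}
  rw [← Finset.sum_fiberwise Finset.univ (fun x : G => (x : G ⧸ K)), Finset.smul_sum]
  refine Finset.sum_congr rfl fun q _ => ?_
  rw [Finset.sum_congr rfl fun x hx => by rw [(Finset.mem_filter.mp hx).2],
    Finset.sum_const, hfiber]

/-- If `K` is a normal subgroup of a finite group `G`, then
`ψ(G) ≤ |K| ^ 2 * ψ(G / K) - |K| + 1`. -/
theorem psiSum_le_sq_mul_psiSum_quotient {G : Type*} [Group G] [Finite G]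
    (K : Subgroup G) [K.Normal] :
    (psiSum G : ℤ) ≤ (Nat.card K : ℤ) ^ 2 * psiSum (G ⧸ K) - Nat.card K + 1 := by
  classical
  have := Fintype.ofFinite G
  have hsum : ∑ x : G, orderOf x + Nat.card K ≤
      ∑ x : G, Nat.card K * orderOf (x : G ⧸ K) + 1 := by
    rw [← Finset.add_sum_erase _ _ (Finset.mem_univ (1 : G)),
      ← Finset.add_sum_erase _ (fun x : G => Nat.card K * orderOf (x : G ⧸ K))
        (Finset.mem_univ (1 : G))]
    have hle := Finset.sum_le_sum fun x (_ : x ∈ Finset.univ.erase (1 : G)) =>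
      orderOf_le_card_mul_orderOf_quotient_mk K x
    simp only [orderOf_one, QuotientGroup.mk_one, mul_one]
    omega
  rw [← Finset.mul_sum, sum_quotient_mk K orderOf, smul_eq_mul] at hsum
  rw [psiSum, psiSum, finsum_eq_sum_of_fintype, finsum_eq_sum_of_fintype]
  zify at hsum ⊢
  linarith
end

section
/- Let G be a finite group and let K be a subgroup of G. Then ψ(G) ≤ |K| · ψ_K(G) − |K| + 1. -/
theorem relOrder_one {G : Type*} [Group G] (H : Subgroup G) : relOrder H (1 : G) = 1 := by
  have h : 1 ∈ {k : ℕ | 0 < k ∧ (1 : G) ^ k ∈ H} := ⟨one_pos, by simp [H.one_mem]⟩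
  exact le_antisymm (Nat.sInf_le h) (Nat.sInf_mem ⟨1, h⟩).1

theorem orderOf_le_card_mul_relOrder {G : Type*} [Group G] [Finite G] (H : Subgroup G) (x : G) :
    orderOf x ≤ Nat.card H * relOrder H x := by
  have hne : {k : ℕ | 0 < k ∧ x ^ k ∈ H}.Nonempty :=
    ⟨orderOf x, orderOf_pos x, by simp [pow_orderOf_eq_one, H.one_mem]⟩
  obtain ⟨hpos, hmem⟩ : 0 < relOrder H x ∧ x ^ relOrder H x ∈ H := Nat.sInf_mem hne
  refine orderOf_le_of_pow_eq_one (Nat.mul_pos Nat.card_pos hpos) ?_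
  rw [mul_comm, pow_mul]
  exact orderOf_dvd_iff_pow_eq_one.mp (H.orderOf_dvd_natCard hmem)

/-- If `K` is a subgroup of a finite group `G`, then
`ψ(G) ≤ |K| * ψ_K(G) - |K| + 1`. -/
theorem psiSum_le_card_mul_psiRel {G : Type*} [Group G] [Finite G] (K : Subgroup G) :
    (psiSum G : ℤ) ≤ (Nat.card K : ℤ) * psiRel G K - Nat.card K + 1 := by
  classical
  have := Fintype.ofFinite G
  rw [psiSum, psiRel, finsum_eq_sum_of_fintype, finsum_eq_sum_of_fintype,
    ← Finset.add_sum_erase _ (fun x : G => orderOf x) (Finset.mem_univ 1),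
    ← Finset.add_sum_erase _ (fun x : G => relOrder K x) (Finset.mem_univ 1)]
  have h : ∑ x ∈ Finset.univ.erase (1 : G), orderOf x ≤
      Nat.card K * ∑ x ∈ Finset.univ.erase (1 : G), relOrder K x := by
    rw [Finset.mul_sum]
    exact Finset.sum_le_sum fun x _ => orderOf_le_card_mul_relOrder K x
  simp only [orderOf_one, relOrder_one]
  zify at h
  push_cast
  linarith
end

section
/- Let G be a finite group with |G| > 1. Then ψ(G) = |G|² − |G| + 1 if and only if G is cyclic of prime order. -/
/-- In a finite group, `ψ(G)` falls short of `|G| ^ 2 - |G| + 1` by the total of the differences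
`|G| - o(x)` over the nonidentity elements `x`. -/
theorem psiSum_add_sum_card_sub_orderOf (G : Type*) [Group G] [Fintype G] [DecidableEq G] :
    (psiSum G : ℤ) + ∑ x ∈ Finset.univ.erase (1 : G), ((Nat.card G : ℤ) - orderOf x) =
      (Nat.card G : ℤ) ^ 2 - Nat.card G + 1 := by
  have hcard : ((Finset.univ.erase (1 : G)).card : ℤ) = Nat.card G - 1 := by
    rw [Finset.card_erase_of_mem (Finset.mem_univ _), Finset.card_univ, ← Nat.card_eq_fintype_card,
      Nat.cast_sub Nat.card_pos, Nat.cast_one]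
  rw [psiSum, finsum_eq_sum_of_fintype, Nat.cast_sum,
    ← Finset.add_sum_erase _ _ (Finset.mem_univ (1 : G)), orderOf_one, Finset.sum_sub_distrib,
    Finset.sum_const, nsmul_eq_mul, hcard]
  ring

/-- In a finite group, `ψ(G) = |G| ^ 2 - |G| + 1` exactly when every nonidentity element has
order `|G|`. -/
theorem psiSum_eq_card_sq_iff_forall_orderOf {G : Type*} [Group G] [Finite G] :
    (psiSum G : ℤ) = (Nat.card G : ℤ) ^ 2 - Nat.card G + 1 ↔
      ∀ x : G, x ≠ 1 → orderOf x = Nat.card G := by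
  classical
  have := Fintype.ofFinite G
  have hnonneg : ∀ x ∈ Finset.univ.erase (1 : G), 0 ≤ (Nat.card G : ℤ) - orderOf x :=
    fun x _ ↦ sub_nonneg.2 (Nat.cast_le.2 (orderOf_le_card (x := x)))
  rw [← psiSum_add_sum_card_sub_orderOf, left_eq_add, Finset.sum_eq_zero_iff_of_nonneg hnonneg]
  simp [sub_eq_zero, eq_comm]

/-- For a finite group `G` with `|G| > 1`, we have
`ψ(G) = |G| ^ 2 - |G| + 1` if and only if `G` is cyclic of prime order. -/
theorem psiSum_eq_card_sq_iff {G : Type*} [Group G] [Finite G] (h : 1 < Nat.card G) :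
    (psiSum G : ℤ) = (Nat.card G : ℤ) ^ 2 - Nat.card G + 1 ↔
      IsCyclic G ∧ (Nat.card G).Prime := by
  rw [psiSum_eq_card_sq_iff_forall_orderOf]
  constructor
  · intro horder
    obtain ⟨p, hp, hdvd⟩ := Nat.exists_prime_and_dvd h.ne'
    have : Fact p.Prime := ⟨hp⟩
    obtain ⟨x, hx⟩ := exists_prime_orderOf_dvd_card' p hdvd
    have hx1 : x ≠ 1 := fun h1 ↦ hp.ne_one (by rw [← hx, h1, orderOf_one])
    have hxcard := horder x hx1
    exact ⟨isCyclic_of_orderOf_eq_card x hxcard, hxcard ▸ hx.symm ▸ hp⟩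
  · rintro ⟨-, hp⟩ x hx
    exact (hp.eq_one_or_self_of_dvd _ (orderOf_dvd_natCard x)).resolve_left
      (mt orderOf_eq_one_iff.1 hx)
end

section
/- Let G be a finite nilpotent group with Sylow p_i-subgroups G₁, ..., G_k (one for each prime divisor p_i of |G|), and let H be a subgroup of G of the form H = H₁ × ⋯ × H_k with H_i ≤ G_i for each i (identifying G with G₁ × ⋯ × G_k). Then ψ_H(G) = ∏_{i=1}^k ψ_{H_i}(G_i). -/
theorem relOrder_dvd_iff {G : Type*} [Group G] (H : Subgroup G) (x : G) (k : ℕ) :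
    relOrder H x ∣ k ↔ x ^ k ∈ H := by
  constructor
  · rintro ⟨m, rfl⟩
    have hmem : x ^ relOrder H x ∈ H := by
      by_cases hS : {k : ℕ | 0 < k ∧ x ^ k ∈ H}.Nonempty
      · exact (Nat.sInf_mem hS).2
      · rw [relOrder, Set.not_nonempty_iff_eq_empty.mp hS, Nat.sInf_empty, pow_zero]
        exact H.one_mem
    rw [pow_mul]
    exact H.pow_mem hmem m
  · intro hk
    rcases Nat.eq_zero_or_pos k with rfl | hpos
    · exact dvd_zero _
    obtain ⟨hr, hxr⟩ : 0 < relOrder H x ∧ x ^ relOrder H x ∈ H :=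
      Nat.sInf_mem (s := {k : ℕ | 0 < k ∧ x ^ k ∈ H}) ⟨k, hpos, hk⟩
    have hmod : x ^ (k % relOrder H x) ∈ H := by
      rw [← Nat.mod_add_div k (relOrder H x), pow_add, pow_mul] at hk
      exact (H.mul_mem_cancel_right (H.pow_mem hxr _)).mp hk
    by_contra hdvd
    have hle : relOrder H x ≤ k % relOrder H x :=
      Nat.sInf_le ⟨Nat.pos_of_ne_zero fun h => hdvd (Nat.dvd_of_mod_eq_zero h), hmod⟩
    exact absurd (Nat.mod_lt k hr) hle.not_gt

theorem relOrder_dvd_natCard {G : Type*} [Group G] (H : Subgroup G) (x : G) :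
    relOrder H x ∣ Nat.card G := by
  rw [relOrder_dvd_iff, pow_card_eq_one']
  exact H.one_mem

theorem relOrder_comap {G N : Type*} [Group G] [Group N] (f : N →* G) (H : Subgroup G) (x : N) :
    relOrder (H.comap f) x = relOrder H (f x) := by
  simp only [relOrder, Subgroup.mem_comap, map_pow]

theorem psiRel_comap_mulEquiv {G N : Type*} [Group G] [Group N] (e : N ≃* G) (H : Subgroup G) :
    psiRel N (H.comap (e : N →* G)) = psiRel G H := by
  simp only [psiRel, relOrder_comap]
  exact finsum_comp_equiv e.toEquiv

theorem relOrder_pi {ι : Type*} [Fintype ι] {N : ι → Type*} [∀ i, Group (N i)]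
    (hcop : Pairwise fun i j => (Nat.card (N i)).Coprime (Nat.card (N j)))
    (K : ∀ i, Subgroup (N i)) (x : ∀ i, N i) :
    relOrder (Subgroup.pi Set.univ K) x = ∏ i, relOrder (K i) (x i) := by
  refine Nat.dvd_right_iff_eq.mp fun k => ?_
  have hdvd : relOrder (Subgroup.pi Set.univ K) x ∣ k ↔ ∀ i, relOrder (K i) (x i) ∣ k := by
    simp only [relOrder_dvd_iff, Subgroup.mem_pi, Set.mem_univ, true_imp_iff, Pi.pow_apply]
  rw [hdvd]
  refine ⟨fun h => Fintype.prod_dvd_of_isRelPrime (fun i j hij => ?_) h,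
    fun h i => (Finset.dvd_prod_of_mem _ (Finset.mem_univ i)).trans h⟩
  exact Nat.coprime_iff_isRelPrime.mp <| (hcop hij).of_dvd
    (relOrder_dvd_natCard _ _) (relOrder_dvd_natCard _ _)

theorem psiRel_pi {ι : Type*} [Fintype ι] {N : ι → Type*} [∀ i, Group (N i)] [∀ i, Finite (N i)]
    (hcop : Pairwise fun i j => (Nat.card (N i)).Coprime (Nat.card (N j)))
    (K : ∀ i, Subgroup (N i)) :
    psiRel (∀ i, N i) (Subgroup.pi Set.univ K) = ∏ i, psiRel (N i) (K i) := by
  classical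
  have := fun i => Fintype.ofFinite (N i)
  simp only [psiRel, relOrder_pi hcop, finsum_eq_sum_of_fintype]
  rw [Finset.prod_univ_sum, Fintype.piFinset_univ]

/-- An internal direct product of subgroups `K i ≤ P i` pulls back to the product of the `K i`. -/
theorem Subgroup.comap_noncommPiCoprod_iSup {G ι : Type*} [Group G] [Fintype ι]
    {P : ι → Subgroup G} (hcomm : Pairwise fun i j => ∀ x y : G, x ∈ P i → y ∈ P j → Commute x y)
    (hinj : Function.Injective (Subgroup.noncommPiCoprod hcomm))
    (K : ι → Subgroup G) (hK : ∀ i, K i ≤ P i) :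
    (⨆ i, K i).comap (Subgroup.noncommPiCoprod hcomm) =
      Subgroup.pi Set.univ fun i => (K i).subgroupOf (P i) := by
  classical
  have hcommK : Pairwise fun i j => ∀ x y : G, x ∈ K i → y ∈ K j → Commute x y :=
    fun i j hij x y hx hy => hcomm hij x y (hK i hx) (hK j hy)
  ext u
  rw [Subgroup.mem_comap, ← Subgroup.noncommPiCoprod_range (hcomm := hcommK), Subgroup.mem_pi]
  constructor
  · rintro ⟨v, hv⟩ i -
    have huv : (fun i => (⟨v i, hK i (v i).2⟩ : P i)) = u := by
      apply hinj
      rw [← hv, Subgroup.noncommPiCoprod_apply, Subgroup.noncommPiCoprod_apply]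
    rw [← huv, Subgroup.mem_subgroupOf]
    exact (v i).2
  · intro h
    refine ⟨fun i => ⟨u i, h i (Set.mem_univ i)⟩, ?_⟩
    rw [Subgroup.noncommPiCoprod_apply, Subgroup.noncommPiCoprod_apply]

/-- Let `G` be a finite nilpotent group, `P p` a Sylow `p`-subgroup
of `G` for each prime `p`, and let `H` be a subgroup of `G` which is the (internal)
product of subgroups `Hp p ≤ P p` over the primes `p` dividing `|G|`. Then
`ψ_H(G) = ∏ p, ψ_{Hp p}(P p)`. -/
theorem psiRel_eq_prod_psiRel_sylow {G : Type*} [Group G] [Finite G]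
    (hG : Group.IsNilpotent G) (P : ∀ p : ℕ, Sylow p G) (Hp : ∀ p : ℕ, Subgroup G)
    (hHp : ∀ p ∈ (Nat.card G).primeFactors, Hp p ≤ (P p : Subgroup G))
    (H : Subgroup G) (hH : H = ⨆ p ∈ (Nat.card G).primeFactors, Hp p) :
    psiRel G H =
      ∏ p ∈ (Nat.card G).primeFactors,
        psiRel (P p : Subgroup G) ((Hp p).subgroupOf (P p : Subgroup G)) := by
  classical
  have hfact (p : (Nat.card G).primeFactors) : Fact p.1.Prime :=
    ⟨Nat.prime_of_mem_primeFactors p.2⟩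
  have hcop : Pairwise fun p q : (Nat.card G).primeFactors =>
      (Nat.card (P p)).Coprime (Nat.card (P q)) := fun p q hne =>
    IsPGroup.coprime_card_of_ne p.1 q.1 (Subtype.coe_ne_coe.mpr hne) _ _
      (P p).isPGroup' (P q).isPGroup'
  have hcomm : Pairwise fun p q : (Nat.card G).primeFactors =>
      ∀ x y : G, x ∈ (P p : Subgroup G) → y ∈ (P q : Subgroup G) → Commute x y := fun p q hne =>
    Subgroup.commute_of_normal_of_disjoint _ _ inferInstance inferInstance
      (IsPGroup.disjoint_of_ne p.1 q.1 (Subtype.coe_ne_coe.mpr hne) _ _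
        (P p).isPGroup' (P q).isPGroup')
  have hinj : Function.Injective (Subgroup.noncommPiCoprod hcomm) := by
    have := fun p : (Nat.card G).primeFactors => Fintype.ofFinite (P p)
    refine Subgroup.injective_noncommPiCoprod_of_iSupIndep
      (Subgroup.independent_of_coprime_order hcomm fun p q hne => ?_)
    simpa only [← Nat.card_eq_fintype_card] using hcop hne
  have hcard : Nat.card (∀ p : (Nat.card G).primeFactors, P p) = Nat.card G := by
    rw [Nat.card_pi]
    calc ∏ p : (Nat.card G).primeFactors, Nat.card (P p)
        = ∏ p : (Nat.card G).primeFactors, p.1 ^ (Nat.card G).factorization p.1 :=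
          Finset.prod_congr rfl fun p _ => (P p).card_eq_multiplicity
      _ = ∏ p ∈ (Nat.card G).primeFactors, p ^ (Nat.card G).factorization p :=
          Finset.prod_coe_sort _ fun p => p ^ (Nat.card G).factorization p
      _ = Nat.card G := Nat.prod_factorization_pow_eq_self Nat.card_pos.ne'
  let e := MulEquiv.ofBijective (Subgroup.noncommPiCoprod hcomm)
    ((Nat.bijective_iff_injective_and_card _).mpr ⟨hinj, hcard⟩)
  have hcomap : H.comap (e : (∀ p : (Nat.card G).primeFactors, P p) →* G) =
      Subgroup.pi Set.univ fun p : (Nat.card G).primeFactors =>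
        (Hp p).subgroupOf (P p : Subgroup G) := by
    rw [hH, iSup_subtype']
    exact Subgroup.comap_noncommPiCoprod_iSup hcomm hinj (fun p => Hp p) fun p => hHp p p.2
  rw [← psiRel_comap_mulEquiv e, hcomap, psiRel_pi hcop]
  exact Finset.prod_coe_sort _ fun p =>
    psiRel (P p : Subgroup G) ((Hp p).subgroupOf (P p : Subgroup G))
end
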